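/- With e_a, χ, Ω_a, H as above and two transversal vectors ξ, ξ' (η(ξ,χ) ≠ 0 ≠ η(ξ',χ)), the corresponding particular solutions y_*(ξ) = (1/η(ξ,χ)) i(ξ)H and y_*(ξ') differ by a multiple of χ: y_*(ξ) - y_*(ξ') = λχ for some λ ∈ ℝ. -/

import Mathlib

/-- Minkowski bilinear form on ℝ⁴ with signature (+,-,-,-). -/
noncomputable def eta (v w : Fin 4 → ℝ) : ℝ :=
  v 0 * w 0 - v 1 * w 1 - v 2 * w 2 - v 3 * w 3

/-- Determinant of the 4×4 matrix with rows `a, b, c, d`. -/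
noncomputable def det4 (a b c d : Fin 4 → ℝ) : ℝ :=
  Matrix.det (Matrix.of ![a, b, c, d])

theorem det4_expand (a b c d : Fin 4 → ℝ) : det4 a b c d =
    (a 0 * b 1 - a 1 * b 0) * (c 2 * d 3 - c 3 * d 2)
    - (a 0 * b 2 - a 2 * b 0) * (c 1 * d 3 - c 3 * d 1)
    + (a 0 * b 3 - a 3 * b 0) * (c 1 * d 2 - c 2 * d 1)
    + (a 1 * b 2 - a 2 * b 1) * (c 0 * d 3 - c 3 * d 0)
    - (a 1 * b 3 - a 3 * b 1) * (c 0 * d 2 - c 2 * d 0)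
    + (a 2 * b 3 - a 3 * b 2) * (c 0 * d 1 - c 1 * d 0) := by
  simp [det4, Matrix.det_succ_row_zero, Fin.sum_univ_succ, Fin.succAbove]
  ring

/-- Three-term Pluecker relation. -/
theorem det4_plucker (z x y e f g : Fin 4 → ℝ) :
    det4 z x f g * det4 y e f g - det4 z y f g * det4 x e f g
      + det4 z e f g * det4 x y f g = 0 := by
  simp only [det4_expand]
  ring

theorem det4_cycle (z e f g : Fin 4 → ℝ) : det4 z f g e = det4 z e f g := by
  simp only [det4_expand]
  ring

theorem eta_ext (u v : Fin 4 → ℝ) (h : ∀ z, eta z u = eta z v) : u = v := by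
  funext i
  have := h (Pi.single i 1)
  fin_cases i <;> simpa [eta] using this

theorem eta_comb (z u v : Fin 4 → ℝ) (a b : ℝ) :
    eta z (a • u - b • v) = a * eta z u - b * eta z v := by
  simp [eta]; ring

theorem eta_smul_right (z u : Fin 4 → ℝ) (a : ℝ) : eta z (a • u) = a * eta z u := by
  simp [eta]; ring

theorem eta_comb3 (z u v w : Fin 4 → ℝ) (a b c : ℝ) :
    eta z (a • u + b • v + c • w) = a * eta z u + b * eta z v + c * eta z w := by
  simp [eta]; ring

/-- The particular solutions associated to two transversal vectors `ξ, ξ'`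
differ by a multiple of the configuration vector `χ`. -/
theorem stmt4 (e1 e2 e3 χ ξ ξ' w1 w2 w3 w1' w2' w3' : Fin 4 → ℝ)
    (Ω1 Ω2 Ω3 : ℝ)
    (hχ : ∀ v, eta v χ = det4 v e1 e2 e3) (hχ0 : χ ≠ 0)
    (hξ : eta ξ χ ≠ 0) (hξ' : eta ξ' χ ≠ 0)
    (hw1 : ∀ z, eta z w1 = -det4 z ξ e2 e3)
    (hw2 : ∀ z, eta z w2 = -det4 z ξ e3 e1)
    (hw3 : ∀ z, eta z w3 = -det4 z ξ e1 e2)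
    (hw1' : ∀ z, eta z w1' = -det4 z ξ' e2 e3)
    (hw2' : ∀ z, eta z w2' = -det4 z ξ' e3 e1)
    (hw3' : ∀ z, eta z w3' = -det4 z ξ' e1 e2) :
    let ystar := (eta ξ χ)⁻¹ • (Ω1 • w1 + Ω2 • w2 + Ω3 • w3)
    let ystar' := (eta ξ' χ)⁻¹ • (Ω1 • w1' + Ω2 • w2' + Ω3 • w3')
    ∃ lam : ℝ, ystar - ystar' = lam • χ := by
  intro ystar ystar'
  refine ⟨(eta ξ χ)⁻¹ * (eta ξ' χ)⁻¹ * (Ω1 * det4 ξ ξ' e2 e3 + Ω2 * det4 ξ ξ' e3 e1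
    + Ω3 * det4 ξ ξ' e1 e2), eta_ext _ _ fun z => ?_⟩
  simp only [ystar, ystar']
  rw [eta_comb, eta_comb3, eta_comb3, eta_smul_right, hw1, hw2, hw3, hw1', hw2', hw3']
  have p1 := det4_plucker z ξ ξ' e1 e2 e3
  have p2 := det4_plucker z ξ ξ' e2 e3 e1
  have p3 := det4_plucker z ξ ξ' e3 e1 e2
  simp only [det4_cycle _ e1 e2 e3, ← det4_cycle _ e3 e1 e2, ← hχ] at p1 p2 p3
  field_simp
  linear_combination (-Ω1) * p1 - Ω2 * p2 - Ω3 * p3
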